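/- Let C be an information-lossless pushdown compressor with k states, working without an endmarker. Then C must output at least one symbol for every k consecutive input symbols: for all words t,u ∈ Σ* with |u| = k, |C(tu)| > |C(t)|. -/

import Mathlib

/-- A pushdown transducer with input alphabet `In`, output alphabet `Out`,
stack alphabet `Γ` and state set `Q`.  A transition `δ q none z` is a
`λ`-rule (no input symbol is read); `det` is the determinism requirement that
for every state and top stack symbol, either the `λ`-rule or all the reading
rules are undefined; `bottom` requires that the bottom-of-stack symbol `z₀`
is never removed from the bottom of the stack. -/
structure PDT (In Out Γ Q : Type*) where
  δ : Q → Option In → Γ → Option (Q × List Γ)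
  ν : Q → Option In → Γ → List Out
  q₀ : Q
  z₀ : Γ
  det : ∀ q z, δ q none z = none ∨ ∀ b, δ q (some b) z = none
  bottom : ∀ q b p, δ q b z₀ = some p → ∃ q' v, p = (q', v ++ [z₀])

namespace PDT

variable {In Out Γ Q : Type*}

/-- Instantaneous description: current state, stack (top first), remaining
input, and output produced so far. -/
abbrev ID (In Out Γ Q : Type*) := Q × List Γ × List In × List Out

/-- One computation step of a pushdown transducer: either a `λ`-rule, or the
reading of one input symbol; in both cases the top stack symbol is replaced
by a (possibly empty) word and the corresponding output is appended. -/
inductive Step (M : PDT In Out Γ Q) : ID In Out Γ Q → ID In Out Γ Q → Prop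
  | lam {q z s inp out q' v} : M.δ q none z = some (q', v) →
      Step M (q, z :: s, inp, out) (q', v ++ s, inp, out ++ M.ν q none z)
  | read {q z s b inp out q' v} : M.δ q (some b) z = some (q', v) →
      Step M (q, z :: s, b :: inp, out) (q', v ++ s, inp, out ++ M.ν q (some b) z)

/-- An ID is terminal when the input has been entirely read and no `λ`-rule
is enabled. -/
def Terminal (M : PDT In Out Γ Q) : ID In Out Γ Q → Prop
  | (q, s, inp, _) => inp = [] ∧ ∀ z s', s = z :: s' → M.δ q none z = none

/-- `M.Computes w qf o`: the complete run of `M` on input `w` ends in state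
`qf` having produced the total output `o`. -/
def Computes (M : PDT In Out Γ Q) (w : List In) (qf : Q) (o : List Out) : Prop :=
  ∃ s, Relation.ReflTransGen (Step M) (M.q₀, [M.z₀], w, []) (qf, s, [], o) ∧
    Terminal M (qf, s, [], o)

end PDT

/-- A pushdown compressor (working without endmarker) over the alphabet `A`:
a pushdown transducer with input and output alphabet `A` whose computation
terminates on every input, hence computing a total function. -/
structure PDC (A Γ Q : Type*) extends PDT A A Γ Q where
  total : ∀ w : List A, ∃ qf o, toPDT.Computes w qf o

namespace PDC
variable {A Γ Q : Type*}

/-- The state `δ_Q(w)` reached by the compressor after processing `w`. -/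
noncomputable def finalState (M : PDC A Γ Q) (w : List A) : Q := (M.total w).choose

/-- `M.output w` is `C(w)`, the output of the compressor on input `w`. -/
noncomputable def output (M : PDC A Γ Q) (w : List A) : List A :=
  (M.total w).choose_spec.choose

/-- Information-losslessness: the map `w ↦ (C(w), δ_Q(w))` is injective. -/
def IL (M : PDC A Γ Q) : Prop :=
  Function.Injective fun w => (M.output w, M.finalState w)


end PDC

namespace PDT

variable {In Out Γ Q : Type*} {M : PDT In Out Γ Q}

/-- Appending unread input does not affect a computation step. -/
theorem Step.append_input {c d : ID In Out Γ Q} (h : Step M c d) (u : List In) :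
    Step M (c.1, c.2.1, c.2.2.1 ++ u, c.2.2.2) (d.1, d.2.1, d.2.2.1 ++ u, d.2.2.2) := by
  cases h with
  | lam h => exact .lam h
  | read h => exact .read h

/-- The output produced so far is only ever extended. -/
theorem Step.output_prefix {c d : ID In Out Γ Q} (h : Step M c d) :
    c.2.2.2 <+: d.2.2.2 := by
  cases h <;> exact List.prefix_append _ _

/-- A pushdown transducer is deterministic. -/
theorem Step.rightUnique (M : PDT In Out Γ Q) : Relator.RightUnique (Step M) := by
  intro a b c hab hac
  cases hab with
  | @lam q z _ _ _ _ _ h =>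
    cases hac with
    | lam h' => simp_all
    | @read _ _ _ b _ _ _ _ h' => rcases M.det q z with hd | hd <;> simp_all
  | @read q z _ _ _ _ _ _ h =>
    cases hac with
    | lam h' => rcases M.det q z with hd | hd <;> simp_all
    | read h' => simp_all

theorem Terminal.not_step {c d : ID In Out Γ Q} (hc : Terminal M c) : ¬ Step M c d := by
  intro h
  obtain ⟨hinp, hlam⟩ := hc
  cases h with
  | lam h => simp_all
  | read h => simp at hinp

theorem reflTransGen_append_input {c d : ID In Out Γ Q}
    (h : Relation.ReflTransGen (Step M) c d) (u : List In) :
    Relation.ReflTransGen (Step M)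
      (c.1, c.2.1, c.2.2.1 ++ u, c.2.2.2) (d.1, d.2.1, d.2.2.1 ++ u, d.2.2.2) :=
  h.lift (fun e : ID In Out Γ Q => (e.1, e.2.1, e.2.2.1 ++ u, e.2.2.2))
    fun _ _ hs => hs.append_input u

theorem reflTransGen_output_prefix {c d : ID In Out Γ Q}
    (h : Relation.ReflTransGen (Step M) c d) : c.2.2.2 <+: d.2.2.2 := by
  induction h with
  | refl => exact List.prefix_rfl
  | tail _ hs ih => exact ih.trans hs.output_prefix

/-- Without an endmarker, outputs extend along prefixes of the input. -/
theorem Computes.output_prefix {w u : List In} {q q' : Q} {o o' : List Out}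
    (h : Computes M w q o) (h' : Computes M (w ++ u) q' o') : o <+: o' := by
  obtain ⟨s, hr, -⟩ := h
  obtain ⟨s', hr', ht'⟩ := h'
  have hru := reflTransGen_append_input hr u
  rcases Relation.ReflTransGen.total_of_right_unique (Step.rightUnique M) hru hr' with h | h
  · exact reflTransGen_output_prefix h
  · rcases h.cases_head with h | ⟨e, he, -⟩
    · simp only [Prod.mk.injEq] at h
      rw [h.2.2.2]
    · exact (ht'.not_step he).elim

end PDT

namespace PDC

variable {A Γ Q : Type*}

theorem computes_output (C : PDC A Γ Q) (w : List A) :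
    C.toPDT.Computes w (C.finalState w) (C.output w) :=
  (C.total w).choose_spec.choose_spec

theorem output_mono (C : PDC A Γ Q) {v w : List A} (h : v <+: w) :
    C.output v <+: C.output w := by
  obtain ⟨u, rfl⟩ := h
  exact (C.computes_output v).output_prefix (C.computes_output (v ++ u))

end PDC

/-- Let `C` be an information-lossless pushdown compressor
with `k` states, working without an endmarker.  Then `C` must output at least
one symbol for every `k` consecutive input symbols: for all words `t, u` with
`|u| = k`, `|C(tu)| > |C(t)|`. -/
theorem ilpdc_output_every_k {A Γ Q : Type} [Fintype A] [Fintype Γ] [Fintype Q]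
    (hA : 2 ≤ Fintype.card A) (C : PDC A Γ Q) (hIL : C.IL) (k : ℕ)
    (hk : Fintype.card Q = k) (t u : List A) (hu : u.length = k) :
    (C.output t).length < (C.output (t ++ u)).length := by
  by_contra! hle
  have hconst (i : ℕ) : C.output (t ++ u.take i) = C.output t := by
    have h₁ : C.output t <+: C.output (t ++ u.take i) :=
      C.output_mono (List.prefix_append _ _)
    have h₂ : C.output (t ++ u.take i) <+: C.output (t ++ u) :=
      C.output_mono ((List.prefix_append_right_inj t).2 (List.take_prefix i u))
    exact (h₁.eq_of_length_le (h₂.length_le.trans hle)).symm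
  obtain ⟨i, j, hij, hq⟩ := Fintype.exists_ne_map_eq_of_card_lt
    (fun i : Fin (k + 1) => C.finalState (t ++ u.take i)) (by simp [hk])
  have heq := hIL (Prod.ext ((hconst i).trans (hconst j).symm) hq)
  have hlen := congrArg List.length heq
  simp only [List.length_append, List.length_take] at hlen
  exact hij (Fin.ext (by omega))
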